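/- arXiv:2311.16062 — 4 statements merged into one kernel-verified Lean document; each statement's English description precedes it below -/
import Mathlib

section
/- Fix ε > 0 and n > 0. The function V(g) = n·(e^ε + g − 1)²/((e^ε − 1)²·(g − 1)), defined for real g > 1, attains its unique minimum at g = e^ε + 1, and the minimum value is V(e^ε + 1) = n·4·e^ε/(e^ε − 1)². (This is the variance of the Optimal Local Hash estimator as a function of the hashed-domain size g, minimized by the choice g = e^ε + 1.) -/
open Real

/-- Fix `ε > 0` and `n > 0`. The function `V(g) = n·(e^ε + g − 1)²/((e^ε − 1)²·(g − 1))`,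
defined for real `g > 1`, attains its unique minimum at `g = e^ε + 1`, and the minimum value
is `V(e^ε + 1) = n·4·e^ε/(e^ε − 1)²`. -/
theorem olh_variance_min (ε : ℝ) (hε : 0 < ε) (n : ℝ) (hn : 0 < n)
    (V : ℝ → ℝ)
    (hV : ∀ g : ℝ, 1 < g →
      V g = n * (exp ε + g - 1) ^ 2 / ((exp ε - 1) ^ 2 * (g - 1))) :
    (∀ g : ℝ, 1 < g → V (exp ε + 1) ≤ V g) ∧
    (∀ g : ℝ, 1 < g → g ≠ exp ε + 1 → V (exp ε + 1) < V g) ∧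
    V (exp ε + 1) = n * 4 * exp ε / (exp ε - 1) ^ 2 := by
  have hE : 1 < exp ε := one_lt_exp_iff.2 hε
  have hE' : exp ε - 1 ≠ 0 := (sub_pos.2 hE).ne'
  have hmin : V (exp ε + 1) = n * 4 * exp ε / (exp ε - 1) ^ 2 := by
    rw [hV _ (by linarith), add_sub_cancel_right, ← add_assoc, add_sub_cancel_right]
    field_simp
    ring
  have hgap : ∀ g : ℝ, 1 < g →
      V g - V (exp ε + 1) = n * (g - (exp ε + 1)) ^ 2 / ((exp ε - 1) ^ 2 * (g - 1)) := by
    intro g hg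
    have hg' : g - 1 ≠ 0 := (sub_pos.2 hg).ne'
    rw [hmin, hV g hg]
    field_simp
    ring
  refine ⟨fun g hg => ?_, fun g hg hne => ?_, hmin⟩
  · have hg' : 0 < g - 1 := sub_pos.2 hg
    rw [← sub_nonneg, hgap g hg]
    positivity
  · have hg' : 0 < g - 1 := sub_pos.2 hg
    have hne' : g - (exp ε + 1) ≠ 0 := sub_ne_zero.2 hne
    rw [← sub_pos, hgap g hg]
    positivity
end

section
/- The M_hot mechanism with privacy parameter ε₂ > 0 satisfies ε₂-local differential privacy: for every pair of inputs v, v' drawn from the full domain (hot or cold) and every output r ∈ H, Pr[M_hot(v) = r] ≤ e^{ε₂} · Pr[M_hot(v') = r]. In particular, for v hot and v' cold, Pr[r | v ∈ Ω_h] / Pr[r | v' ∈ Ω_c] ≤ p₂ / (1/k) ≤ p₂/q₂ = e^{ε₂}. -/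
open Real

/-- The `M_hot` mechanism with privacy parameter `ε₂ > 0` satisfies `ε₂`-local differential
privacy: for every pair of inputs `v, v'` drawn from the full domain (hot or cold) and every
output `r ∈ H`, `Pr[M_hot(v) = r] ≤ e^{ε₂} · Pr[M_hot(v') = r]`. Here the set of hot items is
the set `H` of `k ≥ 2` items currently recorded as hot. -/
theorem mhot_ldp {α : Type*} [DecidableEq α]
    (k : ℕ) (hk : 2 ≤ k) (H : Finset α) (hH : H.card = k)
    (ε₂ : ℝ) (hε₂ : 0 < ε₂) (P : α → α → ℝ)
    (hPhot : ∀ v ∈ H, ∀ r ∈ H,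
      P v r = if r = v then exp ε₂ / (exp ε₂ + k - 1) else 1 / (exp ε₂ + k - 1))
    (hPcold : ∀ v : α, v ∉ H → ∀ r ∈ H, P v r = 1 / k) :
    ∀ v v' : α, ∀ r ∈ H, P v r ≤ exp ε₂ * P v' r := by
  have he : 1 ≤ exp ε₂ := one_le_exp hε₂.le
  have hk' : (2 : ℝ) ≤ k := by exact_mod_cast hk
  have hD : 0 < exp ε₂ + k - 1 := by linarith
  have bounds : ∀ v : α, ∀ r ∈ H,
      1 / (exp ε₂ + k - 1) ≤ P v r ∧ P v r ≤ exp ε₂ / (exp ε₂ + k - 1) := by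
    intro v r hr
    have hpq : 1 / (exp ε₂ + k - 1) ≤ exp ε₂ / (exp ε₂ + k - 1) := by gcongr
    by_cases hv : v ∈ H
    · rw [hPhot v hv r hr]
      split_ifs
      · exact ⟨hpq, le_rfl⟩
      · exact ⟨le_rfl, hpq⟩
    · rw [hPcold v hv r hr]
      constructor
      · exact one_div_le_one_div_of_le (by linarith) (by linarith)
      · rw [div_le_div_iff₀ (by linarith) hD]
        nlinarith
  intro v v' r hr
  calc P v r ≤ exp ε₂ * (1 / (exp ε₂ + k - 1)) := by
        rw [mul_one_div]
        exact (bounds v r hr).2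
    _ ≤ exp ε₂ * P v' r := by
        gcongr
        exact (bounds v' r hr).1
end

section
/- The M_cold mechanism with privacy parameter ε₂ > 0 satisfies ε₂-local differential privacy: for every pair of inputs v, v' drawn from the full domain (hot or cold) and every output r in the cold domain Ω \ H of size d − k, Pr[M_cold(v) = r] ≤ e^{ε₂} · Pr[M_cold(v') = r]. -/
open Real

/-- The `M_cold` mechanism with privacy parameter `ε₂ > 0` satisfies `ε₂`-local differential
privacy: for every pair of inputs `v, v'` drawn from the full domain `Ω` (hot or cold) and
every output `r` in the cold domain `Ω \ H` of size `d − k`,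
`Pr[M_cold(v) = r] ≤ e^{ε₂} · Pr[M_cold(v') = r]`. -/
theorem mcold_ldp {α : Type*} [DecidableEq α]
    (d k : ℕ) (Ω : Finset α) (hΩ : Ω.card = d)
    (H : Finset α) (hHsub : H ⊆ Ω) (hH : H.card = k) (hdk : 2 ≤ d - k)
    (ε₂ : ℝ) (hε₂ : 0 < ε₂) (P : α → α → ℝ)
    (hPcold : ∀ v ∈ Ω, v ∉ H → ∀ r ∈ Ω \ H,
      P v r = if r = v then exp ε₂ / (exp ε₂ + (d - k : ℕ) - 1)
        else 1 / (exp ε₂ + (d - k : ℕ) - 1))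
    (hPhot : ∀ v ∈ H, ∀ r ∈ Ω \ H, P v r = 1 / (d - k : ℕ)) :
    ∀ v ∈ Ω, ∀ v' ∈ Ω, ∀ r ∈ Ω \ H, P v r ≤ exp ε₂ * P v' r := by
  have hn : (2 : ℝ) ≤ (d - k : ℕ) := by exact_mod_cast hdk
  have hE : 1 < exp ε₂ := one_lt_exp_iff.mpr hε₂
  generalize exp ε₂ = E at *
  generalize ((d - k : ℕ) : ℝ) = n at *
  have hD : 0 < E + n - 1 := by linarith
  have bounds : ∀ v ∈ Ω, ∀ r ∈ Ω \ H,
      1 / (E + n - 1) ≤ P v r ∧ P v r ≤ E / (E + n - 1) := by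
    intro v hv r hr
    have hle : 1 / (E + n - 1) ≤ E / (E + n - 1) := by gcongr
    by_cases hvH : v ∈ H
    · rw [hPhot v hvH r hr]
      constructor
      · exact one_div_le_one_div_of_le (by linarith) (by linarith)
      · rw [div_le_div_iff₀ (by linarith) hD]
        nlinarith [mul_nonneg (sub_nonneg.mpr hE.le) (show 0 ≤ n - 1 by linarith)]
    · rw [hPcold v hv hvH r hr]
      split_ifs
      · exact ⟨hle, le_rfl⟩
      · exact ⟨le_rfl, hle⟩
  intro v hv v' hv' r hr
  calc P v r ≤ E / (E + n - 1) := (bounds v hv r hr).2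
    _ = E * (1 / (E + n - 1)) := by ring
    _ ≤ E * P v' r := mul_le_mul_of_nonneg_left (bounds v' hv' r hr).1 (by linarith)
end

section
/- The composed BDR randomizer satisfies (ε₁ + ε₂)-local differential privacy: for every pair of inputs v, v' ∈ Ω and every possible output o (either a pair (Hot, r) with r ∈ H, or a pair (Cold, r) with r ∈ Ω \ H), the probability of producing o on input v is at most e^{ε₁ + ε₂} times the probability of producing o on input v'. Hence BDR satisfies ε-LDP with ε = ε₁ + ε₂. -/
open Real

/-- The probabilities of generalized randomized response over `n` items, scaled by the larger
judging probability, lie between `c` and `a * b * c`, where `c = 1 / ((a + 1) * (b + n - 1))`. -/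
lemma randomizedResponse_mem_Icc {a b n : ℝ} (ha : 1 ≤ a) (hb : 1 ≤ b) (hn : 1 ≤ n)
    (p : Prop) [Decidable p] :
    a / (a + 1) * (if p then b / (b + n - 1) else 1 / (b + n - 1)) ∈
      Set.Icc (1 / ((a + 1) * (b + n - 1))) (a * b * (1 / ((a + 1) * (b + n - 1)))) := by
  have hs : 0 < b + n - 1 := by linarith
  have hab : a ≤ a * b := le_mul_of_one_le_right (by linarith) hb
  have hc : 0 ≤ 1 / ((a + 1) * (b + n - 1)) := by positivity
  split_ifs
  · have h : a / (a + 1) * (b / (b + n - 1)) = a * b * (1 / ((a + 1) * (b + n - 1))) := by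
      field_simp
    rw [h]
    exact ⟨le_mul_of_one_le_left hc (ha.trans hab), le_rfl⟩
  · have h : a / (a + 1) * (1 / (b + n - 1)) = a * (1 / ((a + 1) * (b + n - 1))) := by
      field_simp
    rw [h]
    exact ⟨le_mul_of_one_le_left hc ha, mul_le_mul_of_nonneg_right hab hc⟩

/-- The uniform probability over `n` items, scaled by the smaller judging probability, lies
between `c` and `a * b * c`, where `c = 1 / ((a + 1) * (b + n - 1))`. -/
lemma uniform_mem_Icc {a b n : ℝ} (ha : 1 ≤ a) (hb : 1 ≤ b) (hn : 1 ≤ n) :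
    1 / (a + 1) * (1 / n) ∈
      Set.Icc (1 / ((a + 1) * (b + n - 1))) (a * b * (1 / ((a + 1) * (b + n - 1)))) := by
  have hs : 0 < b + n - 1 := by linarith
  have hbn : b + n - 1 ≤ b * n := by nlinarith
  have hbn' : b * n ≤ a * b * n := by
    rw [mul_assoc]
    exact le_mul_of_one_le_left (by positivity) ha
  rw [one_div_mul_one_div, mul_one_div]
  constructor
  · gcongr
    linarith
  · rw [div_le_div_iff₀ (by positivity) (by positivity)]
    calc 1 * ((a + 1) * (b + n - 1)) ≤ (a + 1) * (a * b * n) := by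
          rw [one_mul]
          gcongr
          exact hbn.trans hbn'
      _ = a * b * ((a + 1) * n) := by ring

/-- Two numbers in an interval `[c, t * c]` with `0 ≤ t` have ratio at most `t`. -/
lemma le_mul_of_mem_Icc {t c x y : ℝ} (ht : 0 ≤ t) (hx : x ∈ Set.Icc c (t * c))
    (hy : y ∈ Set.Icc c (t * c)) : x ≤ t * y :=
  hx.2.trans (mul_le_mul_of_nonneg_left hy.1 ht)

/-- The composed BDR randomizer satisfies `(ε₁ + ε₂)`-local differential privacy: for every
pair of inputs `v, v' ∈ Ω` and every possible output `o` (either `(Hot, r)` with `r ∈ H`,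
encoded as `(true, r)`, or `(Cold, r)` with `r ∈ Ω \ H`, encoded as `(false, r)`), the
probability of producing `o` on input `v` is at most `e^{ε₁ + ε₂}` times the probability of
producing `o` on input `v'`. -/
theorem bdr_ldp {α : Type*} [DecidableEq α]
    (d k : ℕ) (Ω : Finset α) (hΩ : Ω.card = d)
    (H : Finset α) (hHsub : H ⊆ Ω) (hH : H.card = k) (hk : 2 ≤ k) (hdk : 2 ≤ d - k)
    (ε₁ ε₂ : ℝ) (hε₁ : 0 < ε₁) (hε₂ : 0 < ε₂)
    (Q : α → Bool × α → ℝ)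
    (hQ1 : ∀ v ∈ H, ∀ r ∈ H, Q v (true, r) =
      (exp ε₁ / (exp ε₁ + 1)) *
        (if r = v then exp ε₂ / (exp ε₂ + k - 1) else 1 / (exp ε₂ + k - 1)))
    (hQ2 : ∀ v ∈ H, ∀ r ∈ Ω \ H, Q v (false, r) =
      (1 / (exp ε₁ + 1)) * (1 / (d - k : ℕ)))
    (hQ3 : ∀ v ∈ Ω, v ∉ H → ∀ r ∈ H, Q v (true, r) =
      (1 / (exp ε₁ + 1)) * (1 / k))
    (hQ4 : ∀ v ∈ Ω, v ∉ H → ∀ r ∈ Ω \ H, Q v (false, r) =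
      (exp ε₁ / (exp ε₁ + 1)) *
        (if r = v then exp ε₂ / (exp ε₂ + (d - k : ℕ) - 1)
          else 1 / (exp ε₂ + (d - k : ℕ) - 1))) :
    ∀ v ∈ Ω, ∀ v' ∈ Ω, ∀ o : Bool × α,
      ((o.1 = true ∧ o.2 ∈ H) ∨ (o.1 = false ∧ o.2 ∈ Ω \ H)) →
      Q v o ≤ exp (ε₁ + ε₂) * Q v' o := by
  have ha : 1 ≤ exp ε₁ := one_le_exp hε₁.le
  have hb : 1 ≤ exp ε₂ := one_le_exp hε₂.le
  have hk' : (1 : ℝ) ≤ k := by exact_mod_cast (by omega : 1 ≤ k)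
  have hdk' : (1 : ℝ) ≤ (d - k : ℕ) := by exact_mod_cast (by omega : 1 ≤ d - k)
  rintro v hv v' hv' ⟨b, r⟩ (⟨rfl, hr⟩ | ⟨rfl, hr⟩) <;> rw [exp_add]
  · have key : ∀ u ∈ Ω, Q u (true, r) ∈
        Set.Icc (1 / ((exp ε₁ + 1) * (exp ε₂ + k - 1)))
          (exp ε₁ * exp ε₂ * (1 / ((exp ε₁ + 1) * (exp ε₂ + k - 1)))) := by
      intro u hu
      by_cases huH : u ∈ H
      · rw [hQ1 u huH r hr]
        exact randomizedResponse_mem_Icc ha hb hk' _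
      · rw [hQ3 u hu huH r hr]
        exact uniform_mem_Icc ha hb hk'
    exact le_mul_of_mem_Icc (by positivity) (key v hv) (key v' hv')
  · have key : ∀ u ∈ Ω, Q u (false, r) ∈
        Set.Icc (1 / ((exp ε₁ + 1) * (exp ε₂ + (d - k : ℕ) - 1)))
          (exp ε₁ * exp ε₂ * (1 / ((exp ε₁ + 1) * (exp ε₂ + (d - k : ℕ) - 1)))) := by
      intro u hu
      by_cases huH : u ∈ H
      · rw [hQ2 u huH r hr]
        exact uniform_mem_Icc ha hb hdk'
      · rw [hQ4 u hu huH r hr]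
        exact randomizedResponse_mem_Icc ha hb hdk' _
    exact le_mul_of_mem_Icc (by positivity) (key v hv) (key v' hv')
end
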